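/- Under Assumption H with β₁ = 0 and β₃ − β₂T₂/T₁ ≠ 0, there exist ε₂ ∈ (0,ε₁], δ₂ ∈ (0,δ₀] and C > 0 such that for every ε with 0 < |ε| < ε₂ the quantity M(ε) := sup{ Re λ : λ ∈ ℂ is an eigenvalue of L(μ,ε) for some μ ∈ (μ̄−δ₂, μ̄+δ₂) } satisfies | M(ε) − |β₃ − β₂T₂/T₁|·ε⁴ | ≤ C|ε|⁵; that is, the maximal real part of the unstable eigenvalues equals |β₃ − β₂T₂/T₁| ε⁴ (1 + O(ε)). -/

import Mathlib

open Matrix Set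

noncomputable def Jmat : Matrix (Fin 2) (Fin 2) ℂ := !![-Complex.I, 0; 0, Complex.I]

noncomputable def Bmat (a b c : ℝ) : Matrix (Fin 2) (Fin 2) ℂ :=
  !![(a : ℂ), Complex.I * (b : ℂ); -Complex.I * (b : ℂ), (c : ℂ)]

/-- The 2×2 Hamiltonian and reversible matrix `L = J ⬝ B`. -/
noncomputable def Lmat (a b c : ℝ) : Matrix (Fin 2) (Fin 2) ℂ := Jmat * Bmat a b c

/-- `l` is an eigenvalue of `M`, i.e. a root of its characteristic polynomial. -/
def IsEig (M : Matrix (Fin 2) (Fin 2) ℂ) (l : ℂ) : Prop := (Matrix.charpoly M).IsRoot l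

/-- Assumption H: expansions of the real analytic entries `α, β, γ` of the matrix `B(μ,ε)`
around `(μ̄, 0)`, with `T₁ = α₁ + γ₁ > 0`. -/
structure AssumptionH (μb ωs δ₀ ε₀ : ℝ) (α β γ : ℝ → ℝ → ℝ)
    (α₁ α₂ β₁ β₂ β₃ γ₁ γ₂ : ℝ) : Prop where
  hδ₀ : 0 < δ₀
  hε₀ : 0 < ε₀
  hα_an : AnalyticOnNhd ℝ (fun p : ℝ × ℝ => α p.1 p.2)
    (Ioo (μb - δ₀) (μb + δ₀) ×ˢ Ioo (-ε₀) ε₀)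
  hβ_an : AnalyticOnNhd ℝ (fun p : ℝ × ℝ => β p.1 p.2)
    (Ioo (μb - δ₀) (μb + δ₀) ×ˢ Ioo (-ε₀) ε₀)
  hγ_an : AnalyticOnNhd ℝ (fun p : ℝ × ℝ => γ p.1 p.2)
    (Ioo (μb - δ₀) (μb + δ₀) ×ˢ Ioo (-ε₀) ε₀)
  hT₁ : 0 < α₁ + γ₁
  hexp : ∃ α₀ γ₀ : ℝ → ℝ, ∃ d ∈ Ioc (0 : ℝ) δ₀, ∃ e ∈ Ioc (0 : ℝ) ε₀, ∃ C : ℝ, 0 < C ∧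
    AnalyticOnNhd ℝ α₀ (Ioo (-d) d) ∧ AnalyticOnNhd ℝ γ₀ (Ioo (-d) d) ∧
    ∀ δ ε : ℝ, |δ| < d → |ε| < e →
      |α (μb + δ) ε - (-(α₀ δ) + α₂ * ε ^ 2)| ≤ C * (|ε| ^ 3 + |δ| * ε ^ 2 + δ ^ 2 * |ε|) ∧
      |β (μb + δ) ε - (β₁ * ε ^ 2 + β₂ * δ * ε ^ 2 + β₃ * ε ^ 4)| ≤
        C * (|ε| ^ 5 + |δ| * |ε| ^ 3 + δ ^ 2 * ε ^ 2 + |δ| ^ 3 * |ε|) ∧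
      |γ (μb + δ) ε - (γ₀ δ + γ₂ * ε ^ 2)| ≤ C * (|ε| ^ 3 + |δ| * ε ^ 2 + δ ^ 2 * |ε|) ∧
      |α₀ δ - (ωs - α₁ * δ)| ≤ C * δ ^ 2 ∧
      |γ₀ δ - (ωs + γ₁ * δ)| ≤ C * δ ^ 2

/-- The graphs of the real analytic functions `μ₀, μ₊, μ₋` are exactly the zero sets of
`T = α + γ`, `d₊ = T + 2β`, `d₋ = T - 2β` in `(μ̄-δ₀,μ̄+δ₀) × (-ε₁,ε₁)`, with the sign
of these functions positive above the respective graph and negative below it. -/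
structure ZeroCurves (μb δ₀ : ℝ) (α β γ : ℝ → ℝ → ℝ) (ε₁ : ℝ)
    (μ₀ μp μm : ℝ → ℝ) : Prop where
  hμ₀_an : AnalyticOnNhd ℝ μ₀ (Ioo (-ε₁) ε₁)
  hμp_an : AnalyticOnNhd ℝ μp (Ioo (-ε₁) ε₁)
  hμm_an : AnalyticOnNhd ℝ μm (Ioo (-ε₁) ε₁)
  hmaps₀ : ∀ ε ∈ Ioo (-ε₁) ε₁, μ₀ ε ∈ Ioo (μb - δ₀) (μb + δ₀)
  hmapsp : ∀ ε ∈ Ioo (-ε₁) ε₁, μp ε ∈ Ioo (μb - δ₀) (μb + δ₀)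
  hmapsm : ∀ ε ∈ Ioo (-ε₁) ε₁, μm ε ∈ Ioo (μb - δ₀) (μb + δ₀)
  hT : ∀ μ ∈ Ioo (μb - δ₀) (μb + δ₀), ∀ ε ∈ Ioo (-ε₁) ε₁,
    (α μ ε + γ μ ε = 0 ↔ μ = μ₀ ε) ∧
    (μ₀ ε < μ → 0 < α μ ε + γ μ ε) ∧ (μ < μ₀ ε → α μ ε + γ μ ε < 0)
  hdp : ∀ μ ∈ Ioo (μb - δ₀) (μb + δ₀), ∀ ε ∈ Ioo (-ε₁) ε₁,
    (α μ ε + γ μ ε + 2 * β μ ε = 0 ↔ μ = μp ε) ∧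
    (μp ε < μ → 0 < α μ ε + γ μ ε + 2 * β μ ε) ∧ (μ < μp ε → α μ ε + γ μ ε + 2 * β μ ε < 0)
  hdm : ∀ μ ∈ Ioo (μb - δ₀) (μb + δ₀), ∀ ε ∈ Ioo (-ε₁) ε₁,
    (α μ ε + γ μ ε - 2 * β μ ε = 0 ↔ μ = μm ε) ∧
    (μm ε < μ → 0 < α μ ε + γ μ ε - 2 * β μ ε) ∧ (μ < μm ε → α μ ε + γ μ ε - 2 * β μ ε < 0)

theorem isEig_Lmat_iff (a b c : ℝ) (l : ℂ) :
    IsEig (Lmat a b c) l ↔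
      (l - Complex.I * ((c - a) / 2)) ^ 2 = ((b ^ 2 - (a + c) ^ 2 / 4 : ℝ) : ℂ) := by
  have h : (Matrix.charpoly (Lmat a b c)).eval l =
      (l - Complex.I * ((c - a) / 2)) ^ 2 - ((b ^ 2 - (a + c) ^ 2 / 4 : ℝ) : ℂ) := by
    simp only [Matrix.charpoly_fin_two, Lmat, Jmat, Bmat, Matrix.trace_fin_two,
      Matrix.det_fin_two, Matrix.mul_apply, Fin.sum_univ_two]
    simp
    linear_combination (-(a * c) - (c - a) ^ 2 / 4 : ℂ) * Complex.I_sq +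
      (b : ℂ) ^ 2 * (1 - Complex.I ^ 2) * Complex.I_sq
  rw [IsEig, Polynomial.IsRoot, h, sub_eq_zero]

theorem re_sq_of_isEig_Lmat {a b c : ℝ} {l : ℂ} (h : IsEig (Lmat a b c) l) (hl : l.re ≠ 0) :
    l.re ^ 2 = b ^ 2 - (a + c) ^ 2 / 4 := by
  rw [isEig_Lmat_iff] at h
  set w := l - Complex.I * ((c - a) / 2) with hw
  have hre : w.re = l.re := by simp [hw]
  have h1 := congrArg Complex.re h
  have h2 := congrArg Complex.im h
  rw [Complex.ofReal_re, pow_two, Complex.mul_re] at h1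
  rw [Complex.ofReal_im, pow_two, Complex.mul_im] at h2
  rw [← hre] at hl ⊢
  have him : w.im = 0 := by
    have : w.re * w.im = 0 := by linarith
    exact (mul_eq_zero.mp this).resolve_left hl
  rw [him] at h1
  linarith

theorem exists_isEig_Lmat_re_eq_abs {a b c : ℝ} (h : a + c = 0) :
    ∃ l : ℂ, IsEig (Lmat a b c) l ∧ l.re = |b| := by
  refine ⟨(|b| : ℝ) + Complex.I * ((c - a) / 2), ?_, by simp⟩
  rw [isEig_Lmat_iff, h, add_sub_cancel_right, ← Complex.ofReal_pow, sq_abs]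
  norm_num

theorem abs_sub_linear_le {T T₁ T₂ C δ ε η : ℝ} (hC : 0 < C) (hη1 : η ≤ 1)
    (hη : 6 * C * η ≤ T₁ / 4) (hδ : |δ| ≤ η) (hε : |ε| ≤ η)
    (hT : |T - (T₁ * δ + T₂ * ε ^ 2)| ≤
      2 * C * (|ε| ^ 3 + |δ| * |ε| ^ 2 + |δ| ^ 2 * |ε| + |δ| ^ 2)) :
    |T - T₁ * δ| ≤ (|T₂| + 2 * C) * |ε| ^ 2 + T₁ / 4 * |δ| := by
  have ht := abs_nonneg δ
  have hs := abs_nonneg ε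
  have h0 : |T - T₁ * δ| ≤ |T - (T₁ * δ + T₂ * ε ^ 2)| + |T₂| * |ε| ^ 2 := by
    rw [← abs_pow, ← abs_mul]
    rw [show T - T₁ * δ = T - (T₁ * δ + T₂ * ε ^ 2) + T₂ * ε ^ 2 by ring]
    exact abs_add_le _ _
  generalize |δ| = t at *
  generalize |ε| = s at *
  have hs1 : s ≤ 1 := hε.trans hη1
  have h1 : s ^ 3 ≤ s ^ 2 := pow_le_pow_of_le_one hs hs1 (by norm_num)
  have h2 : t * s ^ 2 ≤ η * t := by
    have : s ^ 2 ≤ s := by nlinarith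
    nlinarith
  have h3 : t ^ 2 ≤ η * t := by nlinarith
  have h4 : t ^ 2 * s ≤ η * t := by nlinarith [sq_nonneg t]
  have h5 : C * (s ^ 3 + t * s ^ 2 + t ^ 2 * s + t ^ 2) ≤ C * (s ^ 2 + 3 * (η * t)) :=
    mul_le_mul_of_nonneg_left (by linarith) hC.le
  have h6 := mul_le_mul_of_nonneg_right hη ht
  linarith

theorem exists_abs_sub_le_of_abs_le_two_mul {T₁ C : ℝ} (T₂ β₂ β₃ : ℝ) (hT₁ : 0 < T₁)
    (hC : 0 < C) :
    ∃ C' > 0, ∀ η T b δ ε : ℝ, η ≤ 1 → 6 * C * η ≤ T₁ / 4 →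
      (2 * |β₂| + 6 * C) * η ≤ T₁ / 4 → |δ| ≤ η → |ε| ≤ η →
      |T - (T₁ * δ + T₂ * ε ^ 2)| ≤
        2 * C * (|ε| ^ 3 + |δ| * |ε| ^ 2 + |δ| ^ 2 * |ε| + |δ| ^ 2) →
      |b - (β₂ * δ * ε ^ 2 + β₃ * ε ^ 4)| ≤
        C * (|ε| ^ 5 + |δ| * |ε| ^ 3 + |δ| ^ 2 * |ε| ^ 2 + |δ| ^ 3 * |ε|) →
      |T| ≤ 2 * |b| →
      |b - (β₃ - β₂ * T₂ / T₁) * ε ^ 4| ≤ C' * |ε| ^ 5 := by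
  obtain ⟨P, hP⟩ : ∃ P, P = 2 * (|T₂| + 4 * C + 2 * |β₃|) / T₁ := ⟨_, rfl⟩
  have hP0 : 0 < P := by rw [hP]; positivity
  obtain ⟨R, hR⟩ : ∃ R, R = C * (1 + P + P ^ 2 + P ^ 3) := ⟨_, rfl⟩
  have hR0 : 0 < R := by rw [hR]; positivity
  obtain ⟨B, hB⟩ : ∃ B, B = |β₂| * P + |β₃| + R := ⟨_, rfl⟩
  obtain ⟨G, hG⟩ : ∃ G, G = 2 * B + 2 * C * (1 + P + 2 * P ^ 2) := ⟨_, rfl⟩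
  have hG0 : 0 < G := by rw [hG, hB]; positivity
  refine ⟨|β₂| / T₁ * G + R, by positivity, ?_⟩
  intro η T b δ ε hη1 hη hη' hδ hε hT hb hTb
  have hlin := abs_sub_linear_le hC hη1 hη hδ hε hT
  have ht := abs_nonneg δ
  have hs := abs_nonneg ε
  have hs1 : |ε| ≤ 1 := hε.trans hη1
  have hbδ : |b| ≤ |β₂| * |δ| * |ε| ^ 2 + |β₃| * |ε| ^ 4 +
      C * (|ε| ^ 5 + |δ| * |ε| ^ 3 + |δ| ^ 2 * |ε| ^ 2 + |δ| ^ 3 * |ε|) := by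
    have h1 := abs_add_le (b - (β₂ * δ * ε ^ 2 + β₃ * ε ^ 4)) (β₂ * δ * ε ^ 2 + β₃ * ε ^ 4)
    have h2 := abs_add_le (β₂ * δ * ε ^ 2) (β₃ * ε ^ 4)
    rw [sub_add_cancel] at h1
    simp only [abs_mul, abs_pow] at h2
    linarith
  have hTδ : T₁ * |δ| ≤ |T - T₁ * δ| + |T| := by
    rw [← abs_of_pos hT₁, ← abs_mul, abs_of_pos hT₁]
    have := abs_sub_abs_le_abs_sub (T₁ * δ) T
    rw [abs_sub_comm] at this
    linarith
  have hδP : |δ| ≤ P * |ε| ^ 2 := by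
    generalize |δ| = t at *
    generalize |ε| = s at *
    have hη0 : 0 ≤ η := ht.trans hδ
    have ht1 : t ≤ 1 := hδ.trans hη1
    have e1 : s ^ 2 ≤ η := by nlinarith
    have e1' : s ^ 3 ≤ η := (pow_le_pow_of_le_one hs hs1 (by norm_num)).trans e1
    have e2 : s ^ 4 ≤ s ^ 2 := pow_le_pow_of_le_one hs hs1 (by norm_num)
    have e3 : s ^ 5 ≤ s ^ 2 := pow_le_pow_of_le_one hs hs1 (by norm_num)
    have e4 : t * s ^ 2 ≤ η * t := by nlinarith
    have e5 : t * s ^ 3 ≤ η * t := by nlinarith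
    have e6 : t ^ 2 * s ^ 2 ≤ η * t := by
      have : t * (t * s ^ 2) ≤ 1 * (t * s ^ 2) := by gcongr
      linarith
    have e7 : t ^ 3 * s ≤ η * t := by
      have h1 : t ^ 3 ≤ t := by simpa using pow_le_pow_of_le_one ht ht1 (show 1 ≤ 3 by norm_num)
      have : t ^ 3 * s ≤ t * η := by gcongr
      linarith
    have e8 : C * (s ^ 5 + t * s ^ 3 + t ^ 2 * s ^ 2 + t ^ 3 * s) ≤ C * (s ^ 2 + 3 * (η * t)) :=
      mul_le_mul_of_nonneg_left (by linarith) hC.le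
    have e9 := mul_le_mul_of_nonneg_left e4 (abs_nonneg β₂)
    have e10 := mul_le_mul_of_nonneg_left e2 (abs_nonneg β₃)
    have e11 := mul_le_mul_of_nonneg_right hη' ht
    rw [hP, div_mul_eq_mul_div, le_div_iff₀ hT₁]
    linarith
  have hrem : C * (|ε| ^ 5 + |δ| * |ε| ^ 3 + |δ| ^ 2 * |ε| ^ 2 + |δ| ^ 3 * |ε|) ≤ R * |ε| ^ 5 := by
    generalize |δ| = t at *
    generalize |ε| = s at *
    have e6 : s ^ 6 ≤ s ^ 5 := pow_le_pow_of_le_one hs hs1 (by norm_num)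
    have e7 : s ^ 7 ≤ s ^ 5 := pow_le_pow_of_le_one hs hs1 (by norm_num)
    calc C * (s ^ 5 + t * s ^ 3 + t ^ 2 * s ^ 2 + t ^ 3 * s)
        ≤ C * (s ^ 5 + (P * s ^ 2) * s ^ 3 + (P * s ^ 2) ^ 2 * s ^ 2 + (P * s ^ 2) ^ 3 * s) := by
          gcongr
      _ = C * (s ^ 5 + P * s ^ 5 + P ^ 2 * s ^ 6 + P ^ 3 * s ^ 7) := by ring
      _ ≤ C * (s ^ 5 + P * s ^ 5 + P ^ 2 * s ^ 5 + P ^ 3 * s ^ 5) := by gcongr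
      _ = R * s ^ 5 := by rw [hR]; ring
  have hbB : |b| ≤ B * |ε| ^ 3 := by
    generalize |δ| = t at *
    generalize |ε| = s at *
    have e4 : s ^ 4 ≤ s ^ 3 := pow_le_pow_of_le_one hs hs1 (by norm_num)
    have e5 : s ^ 5 ≤ s ^ 3 := pow_le_pow_of_le_one hs hs1 (by norm_num)
    calc |b| ≤ |β₂| * t * s ^ 2 + |β₃| * s ^ 4 + R * s ^ 5 := by linarith
      _ ≤ |β₂| * (P * s ^ 2) * s ^ 2 + |β₃| * s ^ 4 + R * s ^ 5 := by gcongr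
      _ = |β₂| * P * s ^ 4 + |β₃| * s ^ 4 + R * s ^ 5 := by ring
      _ ≤ |β₂| * P * s ^ 3 + |β₃| * s ^ 3 + R * s ^ 3 := by gcongr
      _ = B * s ^ 3 := by rw [hB]; ring
  have hTrem : 2 * C * (|ε| ^ 3 + |δ| * |ε| ^ 2 + |δ| ^ 2 * |ε| + |δ| ^ 2) ≤
      2 * C * (1 + P + 2 * P ^ 2) * |ε| ^ 3 := by
    generalize |δ| = t at *
    generalize |ε| = s at *
    have e4 : s ^ 4 ≤ s ^ 3 := pow_le_pow_of_le_one hs hs1 (by norm_num)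
    have e5 : s ^ 5 ≤ s ^ 3 := pow_le_pow_of_le_one hs hs1 (by norm_num)
    calc 2 * C * (s ^ 3 + t * s ^ 2 + t ^ 2 * s + t ^ 2)
        ≤ 2 * C * (s ^ 3 + (P * s ^ 2) * s ^ 2 + (P * s ^ 2) ^ 2 * s + (P * s ^ 2) ^ 2) := by
          gcongr
      _ = 2 * C * (s ^ 3 + P * s ^ 4 + P ^ 2 * s ^ 5 + P ^ 2 * s ^ 4) := by ring
      _ ≤ 2 * C * (s ^ 3 + P * s ^ 3 + P ^ 2 * s ^ 3 + P ^ 2 * s ^ 3) := by gcongr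
      _ = 2 * C * (1 + P + 2 * P ^ 2) * s ^ 3 := by ring
  have hcurve : |T₁ * δ + T₂ * ε ^ 2| ≤ G * |ε| ^ 3 := by
    have h1 := abs_sub_abs_le_abs_sub (T₁ * δ + T₂ * ε ^ 2) T
    rw [abs_sub_comm] at h1
    rw [hG]
    linarith
  have hsplit : b - (β₃ - β₂ * T₂ / T₁) * ε ^ 4 =
      (b - (β₂ * δ * ε ^ 2 + β₃ * ε ^ 4)) + β₂ / T₁ * ε ^ 2 * (T₁ * δ + T₂ * ε ^ 2) := by
    field_simp
    ring
  calc |b - (β₃ - β₂ * T₂ / T₁) * ε ^ 4|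
      ≤ |b - (β₂ * δ * ε ^ 2 + β₃ * ε ^ 4)| + |β₂ / T₁ * ε ^ 2 * (T₁ * δ + T₂ * ε ^ 2)| := by
        rw [hsplit]; exact abs_add_le _ _
    _ = |b - (β₂ * δ * ε ^ 2 + β₃ * ε ^ 4)| +
          |β₂| / T₁ * |ε| ^ 2 * |T₁ * δ + T₂ * ε ^ 2| := by
        rw [abs_mul, abs_mul, abs_div, abs_of_pos hT₁, abs_pow]
    _ ≤ R * |ε| ^ 5 + |β₂| / T₁ * |ε| ^ 2 * (G * |ε| ^ 3) := by
        gcongr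
        exact hb.trans hrem
    _ = (|β₂| / T₁ * G + R) * |ε| ^ 5 := by ring

theorem stmt10 (μb ωs δ₀ ε₀ : ℝ) (α β γ : ℝ → ℝ → ℝ) (α₁ α₂ β₁ β₂ β₃ γ₁ γ₂ : ℝ)
    (hH : AssumptionH μb ωs δ₀ ε₀ α β γ α₁ α₂ β₁ β₂ β₃ γ₁ γ₂)
    (hβ₁ : β₁ = 0) (hK : β₃ - β₂ * (α₂ + γ₂) / (α₁ + γ₁) ≠ 0)
    (ε₁ : ℝ) (hε₁ : ε₁ ∈ Ioc (0 : ℝ) ε₀) (μ₀ μp μm : ℝ → ℝ)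
    (hZ : ZeroCurves μb δ₀ α β γ ε₁ μ₀ μp μm) :
    ∃ ε₂ ∈ Ioc (0 : ℝ) ε₁, ∃ δ₂ ∈ Ioc (0 : ℝ) δ₀, ∃ C > (0 : ℝ),
      ∀ ε : ℝ, 0 < |ε| → |ε| < ε₂ →
        |sSup {x : ℝ | ∃ μ ∈ Ioo (μb - δ₂) (μb + δ₂), ∃ l : ℂ,
            IsEig (Lmat (α μ ε) (β μ ε) (γ μ ε)) l ∧ x = l.re} -
          |β₃ - β₂ * (α₂ + γ₂) / (α₁ + γ₁)| * ε ^ 4| ≤ C * |ε| ^ 5 := by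
  obtain ⟨α₀, γ₀, d, ⟨hd0, hdδ⟩, e, ⟨he0, -⟩, C, hC, -, -, hexp⟩ := hH.hexp
  have hT₁ := hH.hT₁
  set T₁ := α₁ + γ₁ with hT₁def
  set T₂ := α₂ + γ₂ with hT₂def
  set K := β₃ - β₂ * T₂ / T₁ with hKdef
  obtain ⟨C', hC', hmain⟩ := exists_abs_sub_le_of_abs_le_two_mul T₂ β₂ β₃ hT₁ hC
  obtain ⟨η, hη0, hηd, hη1, hη⟩ : ∃ η > 0, η < d ∧ η ≤ 1 ∧
      (2 * |β₂| + 6 * C) * η ≤ T₁ / 4 := by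
    have hQ : 0 < 2 * |β₂| + 6 * C := by positivity
    refine ⟨min (d / 2) (min 1 (T₁ / 4 / (2 * |β₂| + 6 * C))), by positivity,
      (min_le_left _ _).trans_lt (by linarith),
      (min_le_right _ _).trans (min_le_left _ _), ?_⟩
    rw [mul_comm, ← le_div_iff₀ hQ]
    exact (min_le_right _ _).trans (min_le_right _ _)
  have hη6 : 6 * C * η ≤ T₁ / 4 := by
    have := mul_nonneg (abs_nonneg β₂) hη0.le
    linarith
  obtain ⟨ε₂, hε₂0, hε₂1, hε₂e, hε₂η, hε₂T⟩ : ∃ ε₂ > 0, ε₂ ≤ ε₁ ∧ ε₂ ≤ e ∧ ε₂ ≤ η ∧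
      (|T₂| + 2 * C) * ε₂ ≤ T₁ * η / 8 := by
    have hQ : 0 < |T₂| + 2 * C := by positivity
    have := hε₁.1
    refine ⟨min (min ε₁ e) (min η (T₁ * η / 8 / (|T₂| + 2 * C))), by positivity,
      (min_le_left _ _).trans (min_le_left _ _), (min_le_left _ _).trans (min_le_right _ _),
      (min_le_right _ _).trans (min_le_left _ _), ?_⟩
    rw [mul_comm, ← le_div_iff₀ hQ]
    exact (min_le_right _ _).trans (min_le_right _ _)
  refine ⟨ε₂, ⟨hε₂0, hε₂1⟩, η, ⟨hη0, hηd.le.trans hdδ⟩, C', hC', fun ε hε0 hε => ?_⟩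
  have hεη : |ε| ≤ η := hε.le.trans hε₂η
  have hTexp : ∀ δ, |δ| ≤ η →
      |α (μb + δ) ε + γ (μb + δ) ε - (T₁ * δ + T₂ * ε ^ 2)| ≤
        2 * C * (|ε| ^ 3 + |δ| * |ε| ^ 2 + |δ| ^ 2 * |ε| + |δ| ^ 2) := by
    intro δ hδ
    obtain ⟨hα, -, hγ, hα₀, hγ₀⟩ := hexp δ ε (hδ.trans_lt hηd) (hε.trans_le hε₂e)
    rw [sq_abs, sq_abs]
    rw [abs_le] at *
    constructor <;> linarith
  have hbound : ∀ δ, |δ| ≤ η →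
      |α (μb + δ) ε + γ (μb + δ) ε| ≤ 2 * |β (μb + δ) ε| →
      |β (μb + δ) ε - K * ε ^ 4| ≤ C' * |ε| ^ 5 := by
    intro δ hδ hTb
    refine hmain η _ _ δ ε hη1 hη6 hη hδ hεη (hTexp δ hδ) ?_ hTb
    have hβ := (hexp δ ε (hδ.trans_lt hηd) (hε.trans_le hε₂e)).2.1
    rw [hβ₁] at hβ
    rw [sq_abs, sq_abs]
    simpa only [zero_mul, zero_add] using hβ
  have hεmem : ε ∈ Ioo (-ε₁) ε₁ := abs_lt.mp (hε.trans_le hε₂1)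
  have hsmall : (|T₂| + 2 * C) * |ε| ^ 2 ≤ T₁ * η / 8 := by
    have h1 : |ε| ^ 2 ≤ ε₂ := by nlinarith [abs_nonneg ε]
    exact (mul_le_mul_of_nonneg_left h1 (by positivity)).trans hε₂T
  have hTη : 0 < T₁ * η := by positivity
  have hright : μ₀ ε ≤ μb + η / 2 := by
    by_contra! hlt
    have habs : |η / 2| = η / 2 := abs_of_pos (by positivity)
    have hneg := (hZ.hT (μb + η / 2) ⟨by linarith, by linarith⟩ ε hεmem).2.2 hlt
    have hlin := abs_sub_linear_le hC hη1 hη6 (by rw [habs]; linarith) hεη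
      (hTexp (η / 2) (by rw [habs]; linarith))
    rw [habs] at hlin
    linarith [(abs_le.mp hlin).1]
  have hleft : μb - η / 2 ≤ μ₀ ε := by
    by_contra! hlt
    rw [sub_eq_add_neg] at hlt
    have habs : |-(η / 2)| = η / 2 := by rw [abs_neg, abs_of_pos (by positivity)]
    have hpos := (hZ.hT (μb + -(η / 2)) ⟨by linarith, by linarith⟩ ε hεmem).2.1 hlt
    have hlin := abs_sub_linear_le hC hη1 hη6 (by rw [habs]; linarith) hεη
      (hTexp (-(η / 2)) (by rw [habs]; linarith))
    rw [habs] at hlin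
    linarith [(abs_le.mp hlin).2]
  have hT0 := (hZ.hT _ (hZ.hmaps₀ ε hεmem) ε hεmem).1.mpr rfl
  have hKε : |K * ε ^ 4| = |K| * ε ^ 4 := by
    rw [abs_mul, abs_of_nonneg (by positivity : 0 ≤ ε ^ 4)]
  set s := {x : ℝ | ∃ μ ∈ Ioo (μb - η) (μb + η), ∃ l : ℂ,
    IsEig (Lmat (α μ ε) (β μ ε) (γ μ ε)) l ∧ x = l.re} with hs
  have hupper : ∀ x ∈ s, x ≤ |K| * ε ^ 4 + C' * |ε| ^ 5 := by
    rintro x ⟨μ, hμ, l, hl, rfl⟩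
    rcases le_or_gt l.re 0 with hneg | hpos
    · exact hneg.trans (by positivity)
    have hre := re_sq_of_isEig_Lmat hl hpos.ne'
    have hre_le : l.re ≤ |β μ ε| := by
      rw [← abs_of_pos hpos]
      exact sq_le_sq.mp (by nlinarith [sq_nonneg (α μ ε + γ μ ε)])
    have hTb : |α μ ε + γ μ ε| ≤ 2 * |β μ ε| := by
      rw [← abs_two, ← abs_mul]
      exact sq_le_sq.mp (by nlinarith [sq_nonneg l.re])
    have hb := hbound (μ - μb) (abs_le.mpr ⟨by linarith [hμ.1], by linarith [hμ.2]⟩)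
    rw [add_sub_cancel] at hb
    have := abs_sub_abs_le_abs_sub (β μ ε) (K * ε ^ 4)
    linarith [hb hTb]
  have hmem : |β (μ₀ ε) ε| ∈ s := by
    obtain ⟨l, hl, hlre⟩ := exists_isEig_Lmat_re_eq_abs (b := β (μ₀ ε) ε) hT0
    exact ⟨μ₀ ε, ⟨by linarith, by linarith⟩, l, hl, hlre.symm⟩
  have hlower : |K| * ε ^ 4 - C' * |ε| ^ 5 ≤ |β (μ₀ ε) ε| := by
    have hb := hbound (μ₀ ε - μb) (abs_le.mpr ⟨by linarith, by linarith⟩)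
    rw [add_sub_cancel, hT0, abs_zero] at hb
    have := abs_sub_abs_le_abs_sub (K * ε ^ 4) (β (μ₀ ε) ε)
    rw [abs_sub_comm] at this
    linarith [hb (by positivity)]
  rw [abs_le]
  constructor
  · linarith [le_csSup ⟨_, hupper⟩ hmem]
  · linarith [csSup_le ⟨_, hmem⟩ hupper]
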